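/- arXiv:2109.08967 — 2 statements merged into one kernel-verified Lean document; each statement's English description precedes it below -/
import Mathlib

section
/- Let n ≥ 2, let e : {1,…,n} → ℝ and f ∈ ℝ, and write ē_n = (e_{n−1} + e_n)/2. Then the correlated-pair probability p_E(n,k,f) satisfies: (i) for integers k with 0 ≤ k ≤ n−2, p_E(n,k,f) = f · p_{E_{n−2}}(n−2, k−2) + 2(ē_n − f) · p_{E_{n−2}}(n−2, k−1) + (1 − 2ē_n + f) · p_{E_{n−2}}(n−2, k); (ii) p_E(n, n−1, f) = f · p_{E_{n−2}}(n−2, n−3) + 2(ē_n − f) · p_{E_{n−2}}(n−2, n−2); (iii) p_E(n, n, f) = f · p_{E_{n−2}}(n−2, n−2). -/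
/-- Poisson binomial probability (integer index `k`, equal to `0` for `k < 0`
or `k > |S|`): the probability that exactly `k` of the classifiers indexed by
`S` make an error, where classifier `i` errs with probability `e i`. -/
noncomputable def pE (S : Finset ℕ) (e : ℕ → ℝ) (k : ℤ) : ℝ :=
  ∑ A ∈ S.powerset.filter (fun A => (A.card : ℤ) = k),
    (∏ i ∈ A, e i) * ∏ j ∈ S \ A, (1 - e j)

/-- The joint factor for the correlated pair of classifiers `n-1` and `n`. -/
noncomputable def gpair (n : ℕ) (e : ℕ → ℝ) (f : ℝ) (A : Finset ℕ) : ℝ :=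
  if n - 1 ∈ A ∧ n ∈ A then f
  else if n - 1 ∈ A then e (n - 1) - f
  else if n ∈ A then e n - f
  else 1 - e (n - 1) - e n + f

/-- Correlated-pair probability that exactly `k` of the `n` classifiers err,
where classifiers `1, …, n-2` are independent and the pair `(n-1, n)` has
joint error probability `f`. -/
noncomputable def pCor (n : ℕ) (e : ℕ → ℝ) (f : ℝ) (k : ℤ) : ℝ :=
  ∑ A ∈ (Finset.Icc 1 n).powerset.filter (fun A => (A.card : ℤ) = k),
    (∏ i ∈ A ∩ Finset.Icc 1 (n - 2), e i) *
      (∏ j ∈ Finset.Icc 1 (n - 2) \ A, (1 - e j)) * gpair n e f A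

theorem pE_eq_sum_ite (S : Finset ℕ) (e : ℕ → ℝ) (k : ℤ) :
    pE S e k = ∑ A ∈ S.powerset,
      if (A.card : ℤ) = k then (∏ i ∈ A, e i) * ∏ j ∈ S \ A, (1 - e j) else 0 := by
  rw [pE, Finset.sum_filter]

theorem pE_eq_zero_of_card_lt {S : Finset ℕ} {k : ℤ} (e : ℕ → ℝ) (h : (S.card : ℤ) < k) :
    pE S e k = 0 := by
  rw [pE, Finset.filter_false_of_mem, Finset.sum_empty]
  intro A hA hk
  have := Finset.card_le_card (Finset.mem_powerset.mp hA)
  omega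

/-- Conditioning on the outcome of the correlated pair, for an arbitrary index `k`. -/
theorem pCor_add_two (m : ℕ) (e : ℕ → ℝ) (f : ℝ) (k : ℤ) :
    pCor (m + 2) e f k =
      f * pE (Finset.Icc 1 m) e (k - 2)
        + (e (m + 1) + e (m + 2) - 2 * f) * pE (Finset.Icc 1 m) e (k - 1)
        + (1 - e (m + 1) - e (m + 2) + f) * pE (Finset.Icc 1 m) e k := by
  have hIcc : Finset.Icc 1 (m + 2) = insert (m + 2) (insert (m + 1) (Finset.Icc 1 m)) := by
    ext x
    simp only [Finset.mem_Icc, Finset.mem_insert]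
    omega
  have h₂ : m + 2 ∉ insert (m + 1) (Finset.Icc 1 m) := by simp
  have h₁ : m + 1 ∉ Finset.Icc 1 m := by simp
  rw [pCor, Finset.sum_filter, hIcc, Finset.sum_powerset_insert h₂,
    Finset.sum_powerset_insert h₁, Finset.sum_powerset_insert h₁]
  simp only [pE_eq_sum_ite, Finset.mul_sum, ← Finset.sum_add_distrib]
  refine Finset.sum_congr rfl fun A hA => ?_
  have hAS := Finset.mem_powerset.mp hA
  have hA₁ : m + 1 ∉ A := fun h => h₁ (hAS h)
  have hA₂ : m + 2 ∉ A := fun h => h₂ (Finset.mem_insert_of_mem (hAS h))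
  have hS₂ : m + 2 ∉ Finset.Icc 1 m := by simp
  have hA₂' : m + 2 ∉ insert (m + 1) A := by simp [hA₂]
  have hk₁ : ((A.card : ℤ) + 1 = k) ↔ ((A.card : ℤ) = k - 1) := by omega
  have hk₂ : ((A.card : ℤ) + 1 + 1 = k) ↔ ((A.card : ℤ) = k - 2) := by omega
  have hne : m + 1 ≠ m + 2 := by omega
  simp only [gpair, Nat.add_sub_cancel, Finset.card_insert_of_notMem hA₁,
    Finset.card_insert_of_notMem hA₂, Finset.card_insert_of_notMem hA₂',
    Finset.insert_inter_of_notMem h₁, Finset.insert_inter_of_notMem hS₂,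
    Finset.sdiff_insert_of_notMem h₁, Finset.sdiff_insert_of_notMem hS₂,
    Finset.inter_eq_left.mpr hAS, Nat.cast_add, Nat.cast_one, hk₁, hk₂,
    show m + 2 - 1 = m + 1 from rfl, Finset.mem_insert, hA₁, hA₂, hne,
    hne.symm, or_true, or_false, and_true, and_false, and_self, if_true, if_false]
  split_ifs <;> ring

theorem stmt10 (n : ℕ) (hn : 2 ≤ n) (e : ℕ → ℝ) (f : ℝ)
    (ebn : ℝ) (hebn : ebn = (e (n - 1) + e n) / 2) :
    (∀ k : ℤ, 0 ≤ k → k ≤ (n : ℤ) - 2 →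
      pCor n e f k =
        f * pE (Finset.Icc 1 (n - 2)) e (k - 2)
          + 2 * (ebn - f) * pE (Finset.Icc 1 (n - 2)) e (k - 1)
          + (1 - 2 * ebn + f) * pE (Finset.Icc 1 (n - 2)) e k) ∧
    pCor n e f ((n : ℤ) - 1) =
      f * pE (Finset.Icc 1 (n - 2)) e ((n : ℤ) - 3)
        + 2 * (ebn - f) * pE (Finset.Icc 1 (n - 2)) e ((n : ℤ) - 2) ∧
    pCor n e f (n : ℤ) = f * pE (Finset.Icc 1 (n - 2)) e ((n : ℤ) - 2) := by
  obtain ⟨m, rfl⟩ := Nat.exists_eq_add_of_le' hn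
  subst hebn
  have hcard : (Finset.Icc 1 m).card = m := by simp
  simp only [pCor_add_two, Nat.add_sub_cancel, show m + 2 - 1 = m + 1 from rfl]
  refine ⟨fun k _ _ => by ring, ?_, ?_⟩
  · rw [pE_eq_zero_of_card_lt (k := ((m + 2 : ℕ) : ℤ) - 1) e (by rw [hcard]; push_cast; omega),
      show ((m + 2 : ℕ) : ℤ) - 1 - 2 = ((m + 2 : ℕ) : ℤ) - 3 by ring,
      show ((m + 2 : ℕ) : ℤ) - 1 - 1 = ((m + 2 : ℕ) : ℤ) - 2 by ring]
    ring
  · rw [pE_eq_zero_of_card_lt (k := ((m + 2 : ℕ) : ℤ) - 1) e (by rw [hcard]; push_cast; omega),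
      pE_eq_zero_of_card_lt (k := ((m + 2 : ℕ) : ℤ)) e (by rw [hcard]; push_cast; omega)]
    ring
end

section
/- (Kaniovski–Zaigraev formula) Let n, m ∈ ℕ with n ≥ 2 and 1 ≤ m ≤ n, let ē ∈ ℝ with 0 < ē < 1, and let c ∈ ℝ. Then ε(n,m,ē,c) = ε(n,m,ē) + (1/2)·c·n(n−1)·((m−1)/(n−1) − ē) · C(n−1, m−1) · ē^{m−1} (1−ē)^{n−m}. -/
/-- Kaniovski–Zaigraev second-order probability of exactly `k` errors out of
`n`, with common error rate `eb` and common pairwise correlation `c`. -/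
noncomputable def piKZ (n k : ℕ) (eb c : ℝ) : ℝ :=
  (n.choose k : ℝ) * eb ^ k * (1 - eb) ^ (n - k) *
    (1 + c * ((k : ℝ) ^ 2 - (k : ℝ) + eb * ((n : ℝ) - 1) * ((n : ℝ) * eb - 2 * k)) /
      (2 * eb * (1 - eb)))

/-- Kaniovski–Zaigraev tail probability: at least `m` errors out of `n`. -/
noncomputable def epsKZ (n m : ℕ) (eb c : ℝ) : ℝ :=
  ∑ k ∈ Finset.Icc m n, piKZ n k eb c

/-- Binomial probability `C(N,k) ē^k (1-ē)^(N-k)`. -/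
noncomputable def pBin (N k : ℕ) (eb : ℝ) : ℝ :=
  (N.choose k : ℝ) * eb ^ k * (1 - eb) ^ (N - k)

/-- Binomial tail probability: at least `m` errors out of `N`. -/
noncomputable def epsBin (N m : ℕ) (eb : ℝ) : ℝ :=
  ∑ k ∈ Finset.Icc m N, pBin N k eb

/-- The boundary term whose successive differences are the correlation corrections. -/
noncomputable def boundaryKZ (n k : ℕ) (eb c : ℝ) : ℝ :=
  c / 2 * n * (((k : ℝ) - 1) - ((n : ℝ) - 1) * eb) *
    (((n - 1).choose (k - 1) : ℝ) * eb ^ (k - 1) * (1 - eb) ^ (n - k))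

theorem boundaryKZ_succ_self {n : ℕ} (hn : 1 ≤ n) (eb c : ℝ) : boundaryKZ n (n + 1) eb c = 0 := by
  have h : (n - 1).choose (n + 1 - 1) = 0 := Nat.choose_eq_zero_of_lt (by omega)
  rw [boundaryKZ, h]
  simp

theorem piKZ_eq_pBin_add_boundaryKZ_sub {n k : ℕ} (hk : 1 ≤ k) (hkn : k ≤ n) {eb : ℝ}
    (h0 : eb ≠ 0) (h1 : 1 - eb ≠ 0) (c : ℝ) :
    piKZ n k eb c = pBin n k eb + (boundaryKZ n k eb c - boundaryKZ n (k + 1) eb c) := by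
  obtain ⟨j, rfl⟩ := Nat.exists_eq_add_of_le' hk
  obtain ⟨d, rfl⟩ := Nat.exists_eq_add_of_le hkn
  have hj : (j : ℝ) + 1 ≠ 0 := by positivity
  have hC : ((j + 1 + d).choose (j + 1) : ℝ) = (j + d + 1) * (j + d).choose j / (j + 1) := by
    have h := Nat.add_one_mul_choose_eq (j + d) j
    rw [eq_div_iff hj, show j + 1 + d = j + d + 1 by omega]
    exact_mod_cast h.symm
  have hC' : ((j + d).choose (j + 1) : ℝ) = (j + d).choose j * d / (j + 1) := by
    have h := Nat.choose_succ_right_eq (j + d) j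
    rw [Nat.add_sub_cancel_left] at h
    rw [eq_div_iff hj]
    exact_mod_cast h
  have e1 : j + 1 + d - 1 = j + d := by omega
  have e2 : j + 1 + d - (j + 1) = d := by omega
  have e3 : j + 1 + d - (j + 1 + 1) = d - 1 := by omega
  simp only [piKZ, pBin, boundaryKZ, e1, e2, e3, Nat.add_sub_cancel, hC, hC']
  rcases d with _ | d
  · push_cast
    field_simp
    ring
  · simp only [Nat.add_sub_cancel]
    push_cast
    field_simp
    ring

/-- The Kaniovski–Zaigraev formula. -/
theorem stmt17 (n m : ℕ) (hn : 2 ≤ n) (hm1 : 1 ≤ m) (hmn : m ≤ n)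
    (eb : ℝ) (h0 : 0 < eb) (h1 : eb < 1) (c : ℝ) :
    epsKZ n m eb c = epsBin n m eb
      + (1 / 2) * c * (n : ℝ) * ((n : ℝ) - 1) *
          (((m : ℝ) - 1) / ((n : ℝ) - 1) - eb) *
          (((n - 1).choose (m - 1) : ℝ) * eb ^ (m - 1) * (1 - eb) ^ (n - m)) := by
  have hn1 : (n : ℝ) - 1 ≠ 0 := by
    have : (2 : ℝ) ≤ n := by exact_mod_cast hn
    linarith
  have htel : ∑ k ∈ Finset.Icc m n, (boundaryKZ n k eb c - boundaryKZ n (k + 1) eb c) =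
      boundaryKZ n m eb c := by
    rw [← Finset.Ico_add_one_right_eq_Icc, Finset.sum_Ico_eq_sum_range]
    have h := Finset.sum_range_sub' (fun i => boundaryKZ n (m + i) eb c) (n + 1 - m)
    simp only [← add_assoc] at h
    rw [h, add_zero, show m + (n + 1 - m) = n + 1 by omega,
      boundaryKZ_succ_self (hm1.trans hmn), sub_zero]
  have hsum : epsKZ n m eb c = epsBin n m eb + boundaryKZ n m eb c := by
    rw [← htel, epsKZ, epsBin, ← Finset.sum_add_distrib]
    refine Finset.sum_congr rfl fun k hk => ?_
    rw [Finset.mem_Icc] at hk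
    exact piKZ_eq_pBin_add_boundaryKZ_sub (hm1.trans hk.1) hk.2 h0.ne' (sub_pos.2 h1).ne' c
  rw [hsum, boundaryKZ]
  congr 1
  field_simp
end
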